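/- arXiv:2404.11435 — 8 statements merged into one kernel-verified Lean document; each statement's English description precedes it below -/
import Mathlib

section
/- (Robbins–Siegmund theorem, deterministic version.) Let (a_k)_{k≥0}, (b_k)_{k≥0}, (c_k)_{k≥0}, (d_k)_{k≥0} be sequences of nonnegative real numbers satisfying a_{k+1} ≤ (1 + b_k)·a_k + c_k − d_k for all k ≥ 0. If Σ_{k=0}^∞ b_k < ∞ and Σ_{k=0}^∞ c_k < ∞, then the sequence (a_k) converges to a finite limit and Σ_{k=0}^∞ d_k < ∞. -/
open Filter

/-- Discrete Grönwall bound for a perturbed linear recursion. -/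
lemma le_exp_sum_mul_of_le_one_add_mul_add {a b c : ℕ → ℝ}
    (ha : 0 ≤ a 0) (hb : ∀ k, 0 ≤ b k) (hc : ∀ k, 0 ≤ c k)
    (hrec : ∀ k, a (k + 1) ≤ (1 + b k) * a k + c k) (n : ℕ) :
    a n ≤ Real.exp (∑ k ∈ Finset.range n, b k) * (a 0 + ∑ k ∈ Finset.range n, c k) := by
  induction n with
  | zero => simp
  | succ n ih =>
    rw [Finset.sum_range_succ, Finset.sum_range_succ, Real.exp_add]
    set B := ∑ k ∈ Finset.range n, b k with hB
    set C := ∑ k ∈ Finset.range n, c k with hC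
    have hB0 : 0 ≤ B := Finset.sum_nonneg fun k _ => hb k
    have hC0 : 0 ≤ C := Finset.sum_nonneg fun k _ => hc k
    have hbn : 0 ≤ 1 + b n := by linarith [hb n]
    have hexp : 1 + b n ≤ Real.exp (b n) := by linarith [Real.add_one_le_exp (b n)]
    have hone : 1 ≤ Real.exp B * Real.exp (b n) := by
      rw [← Real.exp_add]
      exact Real.one_le_exp (add_nonneg hB0 (hb n))
    calc a (n + 1) ≤ (1 + b n) * a n + c n := hrec n
      _ ≤ (1 + b n) * (Real.exp B * (a 0 + C)) + c n := by gcongr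
      _ ≤ Real.exp (b n) * (Real.exp B * (a 0 + C))
          + Real.exp B * Real.exp (b n) * c n :=
        add_le_add (by gcongr) (le_mul_of_one_le_left (hc n) hone)
      _ = Real.exp B * Real.exp (b n) * (a 0 + (C + c n)) := by ring

/-- A nonnegative sequence that decreases by `d` up to summable errors converges, and `d` is
summable. -/
lemma exists_tendsto_and_summable_of_le_add_sub {a d e : ℕ → ℝ}
    (ha : ∀ k, 0 ≤ a k) (hd : ∀ k, 0 ≤ d k) (he : ∀ k, 0 ≤ e k)
    (hrec : ∀ k, a (k + 1) ≤ a k + e k - d k) (hesum : Summable e) :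
    (∃ L : ℝ, Tendsto a atTop (nhds L)) ∧ Summable d := by
  set v : ℕ → ℝ := fun n =>
    a n + ∑ k ∈ Finset.range n, d k - ∑ k ∈ Finset.range n, e k with hv
  have hanti : Antitone v := antitone_nat_of_succ_le fun n => by
    simp only [hv, Finset.sum_range_succ]
    linarith [hrec n]
  have he_le (n : ℕ) : ∑ k ∈ Finset.range n, e k ≤ ∑' k, e k :=
    hesum.sum_le_tsum _ fun k _ => he k
  have hdsum : Summable d := by
    refine summable_of_sum_range_le (c := a 0 + ∑' k, e k) hd fun n => ?_
    have hvn : v n ≤ v 0 := hanti n.zero_le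
    simp only [hv, Finset.range_zero, Finset.sum_empty] at hvn
    linarith [ha n, he_le n]
  have hbdd : BddBelow (Set.range v) := by
    refine ⟨-∑' k, e k, ?_⟩
    rintro _ ⟨n, rfl⟩
    have hdn : 0 ≤ ∑ k ∈ Finset.range n, d k := Finset.sum_nonneg fun k _ => hd k
    simp only [hv]
    linarith [ha n, he_le n]
  have hlim := ((tendsto_atTop_ciInf hanti hbdd).sub hdsum.hasSum.tendsto_sum_nat).add
    hesum.hasSum.tendsto_sum_nat
  refine ⟨⟨_, hlim.congr fun n => ?_⟩, hdsum⟩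
  simp only [hv]
  ring

/-- Robbins–Siegmund theorem, deterministic version.
If nonnegative real sequences satisfy `a (k+1) ≤ (1 + b k) * a k + c k - d k`
and `Σ b k < ∞`, `Σ c k < ∞`, then `a` converges to a finite limit and
`Σ d k < ∞`. -/
theorem stmt1 (a b c d : ℕ → ℝ)
    (ha : ∀ k, 0 ≤ a k) (hb : ∀ k, 0 ≤ b k) (hc : ∀ k, 0 ≤ c k) (hd : ∀ k, 0 ≤ d k)
    (hrec : ∀ k, a (k + 1) ≤ (1 + b k) * a k + c k - d k)
    (hbsum : Summable b) (hcsum : Summable c) :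
    (∃ L : ℝ, Tendsto a atTop (nhds L)) ∧ Summable d := by
  set M := Real.exp (∑' k, b k) * (a 0 + ∑' k, c k) with hM
  have hbound (n : ℕ) : a n ≤ M := by
    refine (le_exp_sum_mul_of_le_one_add_mul_add (ha 0) hb hc
      (fun k => by linarith [hrec k, hd k]) n).trans ?_
    have hC0 : 0 ≤ ∑ k ∈ Finset.range n, c k := Finset.sum_nonneg fun k _ => hc k
    have hbn := hbsum.sum_le_tsum (Finset.range n) fun k _ => hb k
    have hcn := hcsum.sum_le_tsum (Finset.range n) fun k _ => hc k
    exact mul_le_mul (Real.exp_le_exp.mpr hbn) (by linarith) (add_nonneg (ha 0) hC0)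
      (Real.exp_pos _).le
  have hM0 : 0 ≤ M := (ha 0).trans (hbound 0)
  refine exists_tendsto_and_summable_of_le_add_sub (e := fun k => b k * M + c k) ha hd
    (fun k => add_nonneg (mul_nonneg (hb k) hM0) (hc k)) (fun k => ?_)
    ((hbsum.mul_right M).add hcsum)
  linarith [hrec k, mul_le_mul_of_nonneg_left (hbound k) (hb k)]
end

section
/- Suppose (x⁺, y⁺, λ⁺) is a linearized ADMM step from (y^k, λ^k) with parameters β, δ, and set λ̃ = λ^k − β(Ax⁺ + By^k − b). Then for every (x, y, λ) ∈ X × Y × ℝ^m: [θ₁(x) + θ₂(y)] − [θ₁(x⁺) + θ₂(y⁺)] + (x − x⁺)ᵀ(−Aᵀλ̃) + (y − y⁺)ᵀ(−Bᵀλ̃) + (λ − λ̃)ᵀ(Ax⁺ + By⁺ − b) ≥ βδ·(y − y⁺)ᵀ(y^k − y⁺) + (λ − λ̃)ᵀ(−B(y^k − y⁺) + (1/β)(λ^k − λ̃)). -/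
open Matrix Filter

variable {m n₁ n₂ : ℕ}

/-- `(x*, y*, λ*)` is a solution of the variational inequality `VI(F, θ, Ω)`. -/
def VISolution (A : Matrix (Fin m) (Fin n₁) ℝ) (B : Matrix (Fin m) (Fin n₂) ℝ)
    (b : Fin m → ℝ) (X : Set (Fin n₁ → ℝ)) (Y : Set (Fin n₂ → ℝ))
    (θ₁ : (Fin n₁ → ℝ) → ℝ) (θ₂ : (Fin n₂ → ℝ) → ℝ)
    (xs : Fin n₁ → ℝ) (ys : Fin n₂ → ℝ) (ls : Fin m → ℝ) : Prop :=
  xs ∈ X ∧ ys ∈ Y ∧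
    (∀ x ∈ X, θ₁ x - θ₁ xs + (x - xs) ⬝ᵥ (-(Aᵀ *ᵥ ls)) ≥ 0) ∧
    (∀ y ∈ Y, θ₂ y - θ₂ ys + (y - ys) ⬝ᵥ (-(Bᵀ *ᵥ ls)) ≥ 0) ∧
    A *ᵥ xs + B *ᵥ ys = b

/-- `(x⁺, y⁺, λ⁺)` is a linearized ADMM step from `(yk, λk)` with parameters
`β, δ`. -/
def ADMMStep (A : Matrix (Fin m) (Fin n₁) ℝ) (B : Matrix (Fin m) (Fin n₂) ℝ)
    (b : Fin m → ℝ) (X : Set (Fin n₁ → ℝ)) (Y : Set (Fin n₂ → ℝ))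
    (θ₁ : (Fin n₁ → ℝ) → ℝ) (θ₂ : (Fin n₂ → ℝ) → ℝ) (β δ : ℝ)
    (yk : Fin n₂ → ℝ) (lk : Fin m → ℝ)
    (xp : Fin n₁ → ℝ) (yp : Fin n₂ → ℝ) (lp : Fin m → ℝ) : Prop :=
  xp ∈ X ∧ yp ∈ Y ∧
    (∀ x ∈ X, θ₁ x - θ₁ xp +
      (x - xp) ⬝ᵥ (-(Aᵀ *ᵥ lk) + β • (Aᵀ *ᵥ (A *ᵥ xp + B *ᵥ yk - b))) ≥ 0) ∧
    (∀ y ∈ Y, θ₂ y - θ₂ yp +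
      (y - yp) ⬝ᵥ (-(Bᵀ *ᵥ lk) + β • (Bᵀ *ᵥ (A *ᵥ xp + B *ᵥ yk - b))
        + (β * δ) • (yp - yk)) ≥ 0) ∧
    lp = lk - β • (A *ᵥ xp + B *ᵥ yp - b)

/-- Lemma 3.1: the variational characterization of one
linearized ADMM step. -/
theorem stmt5 (hm : 0 < m) (hn₁ : 0 < n₁) (hn₂ : 0 < n₂)
    (A : Matrix (Fin m) (Fin n₁) ℝ) (B : Matrix (Fin m) (Fin n₂) ℝ) (b : Fin m → ℝ)
    (X : Set (Fin n₁ → ℝ)) (Y : Set (Fin n₂ → ℝ))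
    (hXc : IsClosed X) (hXconv : Convex ℝ X) (hYc : IsClosed Y) (hYconv : Convex ℝ Y)
    (θ₁ : (Fin n₁ → ℝ) → ℝ) (θ₂ : (Fin n₂ → ℝ) → ℝ)
    (hθ₁ : ConvexOn ℝ Set.univ θ₁) (hθ₂ : ConvexOn ℝ Set.univ θ₂)
    (β δ : ℝ) (hβ : 0 < β) (hδ : 0 < δ)
    (yk : Fin n₂ → ℝ) (hyk : yk ∈ Y) (lk : Fin m → ℝ)
    (xp : Fin n₁ → ℝ) (yp : Fin n₂ → ℝ) (lp : Fin m → ℝ)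
    (hstep : ADMMStep A B b X Y θ₁ θ₂ β δ yk lk xp yp lp)
    (lt : Fin m → ℝ) (hlt : lt = lk - β • (A *ᵥ xp + B *ᵥ yk - b)) :
    ∀ x ∈ X, ∀ y ∈ Y, ∀ l : Fin m → ℝ,
      (θ₁ x + θ₂ y) - (θ₁ xp + θ₂ yp)
        + (x - xp) ⬝ᵥ (-(Aᵀ *ᵥ lt))
        + (y - yp) ⬝ᵥ (-(Bᵀ *ᵥ lt))
        + (l - lt) ⬝ᵥ (A *ᵥ xp + B *ᵥ yp - b)
      ≥ (β * δ) * ((y - yp) ⬝ᵥ (yk - yp))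
        + (l - lt) ⬝ᵥ (-(B *ᵥ (yk - yp)) + (1 / β) • (lk - lt)) := by
  intro x hx y hy l
  obtain ⟨-, -, h₁, h₂, -⟩ := hstep
  specialize h₁ x hx
  specialize h₂ y hy
  have hA : -(Aᵀ *ᵥ lk) + β • (Aᵀ *ᵥ (A *ᵥ xp + B *ᵥ yk - b)) = -(Aᵀ *ᵥ lt) := by
    rw [hlt, mulVec_sub _ lk, mulVec_smul, neg_sub, neg_add_eq_sub]
  have hB : -(Bᵀ *ᵥ lk) + β • (Bᵀ *ᵥ (A *ᵥ xp + B *ᵥ yk - b)) = -(Bᵀ *ᵥ lt) := by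
    rw [hlt, mulVec_sub _ lk, mulVec_smul, neg_sub, neg_add_eq_sub]
  have hr : -(B *ᵥ (yk - yp)) + (1 / β) • (lk - lt) = A *ᵥ xp + B *ᵥ yp - b := by
    rw [hlt, sub_sub_cancel, smul_smul, one_div_mul_cancel hβ.ne', one_smul, mulVec_sub]
    abel
  rw [hA] at h₁
  rw [hB, dotProduct_add, dotProduct_smul, smul_eq_mul, ← neg_sub yk yp,
    dotProduct_neg _ (yk - yp), mul_neg] at h₂
  rw [hr]
  linarith
end

section
/- Suppose (x*, y*, λ*) is a solution of the variational inequality VI(F, θ, Ω) and (x⁺, y⁺, λ⁺) is a linearized ADMM step from (y^k, λ^k) with parameters β, δ. Then (Ax⁺ − Ax*)ᵀ(λ* − λ⁺) ≤ β·(Ax⁺ − Ax*)ᵀ(By⁺ − By^k). -/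
open Matrix Filter

variable {m n₁ n₂ : ℕ}

/-- `(Ax⁺ − Ax*)ᵀ(λ* − λ⁺) ≤ β·(Ax⁺ − Ax*)ᵀ(By⁺ − By^k)`. -/
theorem stmt7 (hm : 0 < m) (hn₁ : 0 < n₁) (hn₂ : 0 < n₂)
    (A : Matrix (Fin m) (Fin n₁) ℝ) (B : Matrix (Fin m) (Fin n₂) ℝ) (b : Fin m → ℝ)
    (X : Set (Fin n₁ → ℝ)) (Y : Set (Fin n₂ → ℝ))
    (hXc : IsClosed X) (hXconv : Convex ℝ X) (hYc : IsClosed Y) (hYconv : Convex ℝ Y)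
    (θ₁ : (Fin n₁ → ℝ) → ℝ) (θ₂ : (Fin n₂ → ℝ) → ℝ)
    (hθ₁ : ConvexOn ℝ Set.univ θ₁) (hθ₂ : ConvexOn ℝ Set.univ θ₂)
    (β δ : ℝ) (hβ : 0 < β) (hδ : 0 < δ)
    (xs : Fin n₁ → ℝ) (ys : Fin n₂ → ℝ) (ls : Fin m → ℝ)
    (hsol : VISolution A B b X Y θ₁ θ₂ xs ys ls)
    (yk : Fin n₂ → ℝ) (hyk : yk ∈ Y) (lk : Fin m → ℝ)
    (xp : Fin n₁ → ℝ) (yp : Fin n₂ → ℝ) (lp : Fin m → ℝ)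
    (hstep : ADMMStep A B b X Y θ₁ θ₂ β δ yk lk xp yp lp) :
    (A *ᵥ xp - A *ᵥ xs) ⬝ᵥ (ls - lp)
      ≤ β * ((A *ᵥ xp - A *ᵥ xs) ⬝ᵥ (B *ᵥ yp - B *ᵥ yk)) := by
  obtain ⟨hxs, -, hvi, -, -⟩ := hsol
  obtain ⟨hxp, -, hx, -, rfl⟩ := hstep
  have transpose_dot (u : Fin n₁ → ℝ) (v : Fin m → ℝ) :
      u ⬝ᵥ (Aᵀ *ᵥ v) = (A *ᵥ u) ⬝ᵥ v := by
    rw [dotProduct_mulVec, vecMul_transpose]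
  have h₁ := hvi xp hxp
  have h₂ := hx xs hxs
  simp only [dotProduct_add, dotProduct_neg, dotProduct_smul, dotProduct_sub, transpose_dot,
    mulVec_sub, sub_dotProduct, smul_eq_mul] at h₁ h₂ ⊢
  linarith
end

section
/- Suppose (x*, y*, λ*) is a solution of the variational inequality VI(F, θ, Ω) and (x⁺, y⁺, λ⁺) is a linearized ADMM step from (y^k, λ^k) with parameters β, δ. Then δβ·(y⁺ − y*)ᵀ(y⁺ − y^k) − β·(B(y⁺ − y*))ᵀ(B(y⁺ − y^k)) + (By⁺ − By*)ᵀ(λ* − λ⁺) ≤ 0. -/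
open Matrix Filter

variable {m n₁ n₂ : ℕ}

theorem stmt8 (hm : 0 < m) (hn₁ : 0 < n₁) (hn₂ : 0 < n₂)
    (A : Matrix (Fin m) (Fin n₁) ℝ) (B : Matrix (Fin m) (Fin n₂) ℝ) (b : Fin m → ℝ)
    (X : Set (Fin n₁ → ℝ)) (Y : Set (Fin n₂ → ℝ))
    (hXc : IsClosed X) (hXconv : Convex ℝ X) (hYc : IsClosed Y) (hYconv : Convex ℝ Y)
    (θ₁ : (Fin n₁ → ℝ) → ℝ) (θ₂ : (Fin n₂ → ℝ) → ℝ)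
    (hθ₁ : ConvexOn ℝ Set.univ θ₁) (hθ₂ : ConvexOn ℝ Set.univ θ₂)
    (β δ : ℝ) (hβ : 0 < β) (hδ : 0 < δ)
    (xs : Fin n₁ → ℝ) (ys : Fin n₂ → ℝ) (ls : Fin m → ℝ)
    (hsol : VISolution A B b X Y θ₁ θ₂ xs ys ls)
    (yk : Fin n₂ → ℝ) (hyk : yk ∈ Y) (lk : Fin m → ℝ)
    (xp : Fin n₁ → ℝ) (yp : Fin n₂ → ℝ) (lp : Fin m → ℝ)
    (hstep : ADMMStep A B b X Y θ₁ θ₂ β δ yk lk xp yp lp) :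
    δ * β * ((yp - ys) ⬝ᵥ (yp - yk))
      - β * ((B *ᵥ (yp - ys)) ⬝ᵥ (B *ᵥ (yp - yk)))
      + (B *ᵥ yp - B *ᵥ ys) ⬝ᵥ (ls - lp) ≤ 0 := by
  obtain ⟨-, hys, -, hVI, -⟩ := hsol
  obtain ⟨-, hyp, -, hADMM, rfl⟩ := hstep
  have h₁ := hVI yp hyp
  have h₂ := hADMM ys hys
  have adjoint (v : Fin n₂ → ℝ) (w : Fin m → ℝ) : v ⬝ᵥ (Bᵀ *ᵥ w) = (B *ᵥ v) ⬝ᵥ w := by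
    rw [dotProduct_mulVec, vecMul_transpose]
  simp only [dotProduct_add, dotProduct_neg, dotProduct_smul, adjoint, mulVec_sub,
    dotProduct_sub, sub_dotProduct, smul_eq_mul] at h₁ h₂ ⊢
  linarith
end

section
/- Suppose (x*, y*, λ*) is a solution of the variational inequality VI(F, θ, Ω) and (x⁺, y⁺, λ⁺) is a linearized ADMM step from (y^k, λ^k) with parameters β, δ. Then δβ·(y⁺ − y*)ᵀ(y⁺ − y^k) − β·(B(y⁺ − y*))ᵀ(B(y⁺ − y^k)) + (1/β)·(λ^k − λ⁺)ᵀ(λ* − λ⁺) ≤ β·(Ax⁺ − Ax*)ᵀ(By⁺ − By^k). -/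
open Matrix Filter

variable {m n₁ n₂ : ℕ}

theorem dotProduct_transpose_mulVec {k l : ℕ} (M : Matrix (Fin k) (Fin l) ℝ)
    (v : Fin l → ℝ) (w : Fin k → ℝ) : v ⬝ᵥ (Mᵀ *ᵥ w) = (M *ᵥ v) ⬝ᵥ w := by
  rw [dotProduct_mulVec, vecMul_transpose]

/-- Lemma 3.3. -/
theorem stmt9 (hm : 0 < m) (hn₁ : 0 < n₁) (hn₂ : 0 < n₂)
    (A : Matrix (Fin m) (Fin n₁) ℝ) (B : Matrix (Fin m) (Fin n₂) ℝ) (b : Fin m → ℝ)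
    (X : Set (Fin n₁ → ℝ)) (Y : Set (Fin n₂ → ℝ))
    (hXc : IsClosed X) (hXconv : Convex ℝ X) (hYc : IsClosed Y) (hYconv : Convex ℝ Y)
    (θ₁ : (Fin n₁ → ℝ) → ℝ) (θ₂ : (Fin n₂ → ℝ) → ℝ)
    (hθ₁ : ConvexOn ℝ Set.univ θ₁) (hθ₂ : ConvexOn ℝ Set.univ θ₂)
    (β δ : ℝ) (hβ : 0 < β) (hδ : 0 < δ)
    (xs : Fin n₁ → ℝ) (ys : Fin n₂ → ℝ) (ls : Fin m → ℝ)
    (hsol : VISolution A B b X Y θ₁ θ₂ xs ys ls)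
    (yk : Fin n₂ → ℝ) (hyk : yk ∈ Y) (lk : Fin m → ℝ)
    (xp : Fin n₁ → ℝ) (yp : Fin n₂ → ℝ) (lp : Fin m → ℝ)
    (hstep : ADMMStep A B b X Y θ₁ θ₂ β δ yk lk xp yp lp) :
    δ * β * ((yp - ys) ⬝ᵥ (yp - yk))
      - β * ((B *ᵥ (yp - ys)) ⬝ᵥ (B *ᵥ (yp - yk)))
      + (1 / β) * ((lk - lp) ⬝ᵥ (ls - lp))
      ≤ β * ((A *ᵥ xp - A *ᵥ xs) ⬝ᵥ (B *ᵥ yp - B *ᵥ yk)) := by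
  obtain ⟨hxs, hys, hsx, hsy, hsb⟩ := hsol
  obtain ⟨hxp, hyp, hpx, hpy, hl⟩ := hstep
  have h₁ := hsx xp hxp
  have h₂ := hsy yp hyp
  have h₃ := hpx xs hxs
  have h₄ := hpy ys hys
  have hr : A *ᵥ xp + B *ᵥ yp - b = (A *ᵥ xp - A *ᵥ xs) + (B *ᵥ yp - B *ᵥ ys) := by
    rw [← hsb]; abel
  have hk : A *ᵥ xp + B *ᵥ yk - b =
      (A *ᵥ xp - A *ᵥ xs) + (B *ᵥ yp - B *ᵥ ys) - (B *ᵥ yp - B *ᵥ yk) := by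
    rw [← hsb]; abel
  have hxneg : xs - xp = -(xp - xs) := by abel
  have hyneg : ys - yp = -(yp - ys) := by abel
  have hlk : lk = lp + β • ((A *ᵥ xp - A *ᵥ xs) + (B *ᵥ yp - B *ᵥ ys)) := by
    rw [hl, hr]; abel
  rw [hk, hxneg] at h₃
  rw [hk, hyneg] at h₄
  rw [hlk] at h₃ h₄ ⊢
  simp only [neg_dotProduct, dotProduct_add, dotProduct_neg, dotProduct_smul, smul_eq_mul,
    dotProduct_transpose_mulVec] at h₁ h₂ h₃ h₄
  rw [add_sub_cancel_left, smul_dotProduct, smul_eq_mul, one_div, inv_mul_cancel_left₀ hβ.ne']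
  simp only [mulVec_neg, mulVec_sub, neg_dotProduct] at h₁ h₂ h₃ h₄ ⊢
  generalize A *ᵥ xp - A *ᵥ xs = a at *
  generalize B *ᵥ yp - B *ᵥ ys = c at *
  generalize B *ᵥ yp - B *ᵥ yk = d at *
  simp only [add_dotProduct, dotProduct_add, dotProduct_sub a, dotProduct_sub c] at h₃ h₄ ⊢
  linarith
end

section
/- Suppose (x*, y*, λ*) is a solution of the variational inequality VI(F, θ, Ω) and (x⁺, y⁺, λ⁺) is a linearized ADMM step from (y^k, λ^k) with parameters β, δ. Then δβ·‖y⁺ − y*‖² + (1/β)·‖λ⁺ − λ*‖² ≤ δβ·‖y^k − y*‖² + (1/β)·‖λ^k − λ*‖² − (δβ·‖y⁺ − y^k‖² + (1/β)·‖λ⁺ − λ^k‖²) − 2·(λ⁺ − λ^k)ᵀ(By⁺ − By^k). -/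
open Matrix Filter

variable {m n₁ n₂ : ℕ}

/-- The three-point (cosine) identity for the dot product. -/
lemma dotProduct_sub_self_three_point {ι : Type*} [Fintype ι] (a b c : ι → ℝ) :
    (a - c) ⬝ᵥ (a - c) = (b - c) ⬝ᵥ (b - c) - (a - b) ⬝ᵥ (a - b)
      + 2 * ((a - b) ⬝ᵥ (a - c)) := by
  simp only [sub_dotProduct, dotProduct_sub, dotProduct_comm b a, dotProduct_comm c a,
    dotProduct_comm c b]
  ring

/-- Moving a transposed matrix across the dot product. -/
lemma dotProduct_transpose_mulVec_eq {ι κ : Type*} [Fintype ι] [Fintype κ]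
    (M : Matrix ι κ ℝ) (x : κ → ℝ) (v : ι → ℝ) : x ⬝ᵥ (Mᵀ *ᵥ v) = (M *ᵥ x) ⬝ᵥ v := by
  rw [mulVec_transpose, dotProduct_comm, ← dotProduct_mulVec, dotProduct_comm]

/-- Lemma 3.4. -/
theorem stmt10 (hm : 0 < m) (hn₁ : 0 < n₁) (hn₂ : 0 < n₂)
    (A : Matrix (Fin m) (Fin n₁) ℝ) (B : Matrix (Fin m) (Fin n₂) ℝ) (b : Fin m → ℝ)
    (X : Set (Fin n₁ → ℝ)) (Y : Set (Fin n₂ → ℝ))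
    (hXc : IsClosed X) (hXconv : Convex ℝ X) (hYc : IsClosed Y) (hYconv : Convex ℝ Y)
    (θ₁ : (Fin n₁ → ℝ) → ℝ) (θ₂ : (Fin n₂ → ℝ) → ℝ)
    (hθ₁ : ConvexOn ℝ Set.univ θ₁) (hθ₂ : ConvexOn ℝ Set.univ θ₂)
    (β δ : ℝ) (hβ : 0 < β) (hδ : 0 < δ)
    (xs : Fin n₁ → ℝ) (ys : Fin n₂ → ℝ) (ls : Fin m → ℝ)
    (hsol : VISolution A B b X Y θ₁ θ₂ xs ys ls)
    (yk : Fin n₂ → ℝ) (hyk : yk ∈ Y) (lk : Fin m → ℝ)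
    (xp : Fin n₁ → ℝ) (yp : Fin n₂ → ℝ) (lp : Fin m → ℝ)
    (hstep : ADMMStep A B b X Y θ₁ θ₂ β δ yk lk xp yp lp) :
    δ * β * ((yp - ys) ⬝ᵥ (yp - ys)) + (1 / β) * ((lp - ls) ⬝ᵥ (lp - ls))
      ≤ δ * β * ((yk - ys) ⬝ᵥ (yk - ys)) + (1 / β) * ((lk - ls) ⬝ᵥ (lk - ls))
        - (δ * β * ((yp - yk) ⬝ᵥ (yp - yk)) + (1 / β) * ((lp - lk) ⬝ᵥ (lp - lk)))
        - 2 * ((lp - lk) ⬝ᵥ (B *ᵥ yp - B *ᵥ yk)) := by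
  obtain ⟨hxs, hys, hx, hy, rfl⟩ := hsol
  obtain ⟨hxp, hyp, hxk, hyk', hl⟩ := hstep
  have h₁ := add_nonneg (hx xp hxp) (hxk xs hxs)
  have h₂ := add_nonneg (hy yp hyp) (hyk' ys hys)
  obtain rfl : lk = lp + β • (A *ᵥ xp + B *ᵥ yp - (A *ᵥ xs + B *ᵥ ys)) := by
    rw [hl]; abel
  have hβl : 1 / β * ((lp - (lp + β • (A *ᵥ xp + B *ᵥ yp - (A *ᵥ xs + B *ᵥ ys)))) ⬝ᵥ (lp - ls))
      = -((A *ᵥ xp + B *ᵥ yp - (A *ᵥ xs + B *ᵥ ys)) ⬝ᵥ (lp - ls)) := by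
    rw [sub_add_cancel_left, neg_dotProduct, smul_dotProduct, smul_eq_mul]
    field_simp
  rw [dotProduct_sub_self_three_point yp yk ys, dotProduct_sub_self_three_point lp _ ls]
  suffices h : δ * β * ((yp - yk) ⬝ᵥ (yp - ys))
      - (A *ᵥ xp + B *ᵥ yp - (A *ᵥ xs + B *ᵥ ys)) ⬝ᵥ (lp - ls)
      - β * ((A *ᵥ xp + B *ᵥ yp - (A *ᵥ xs + B *ᵥ ys)) ⬝ᵥ (B *ᵥ yp - B *ᵥ yk)) ≤ 0 by
    rw [mul_add (1 / β), mul_left_comm (1 / β) 2, hβl, sub_add_cancel_left lp,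
      neg_dotProduct _ (B *ᵥ yp - B *ᵥ yk), smul_dotProduct, smul_eq_mul]
    linarith
  simp only [dotProduct_add, dotProduct_neg, dotProduct_smul, smul_eq_mul,
    dotProduct_transpose_mulVec_eq] at h₁ h₂
  simp only [mulVec_sub] at h₁ h₂
  generalize A *ᵥ xp = p at *
  generalize A *ᵥ xs = q at *
  generalize B *ᵥ yp = u at *
  generalize B *ᵥ yk = v at *
  generalize B *ᵥ ys = s at *
  simp only [sub_dotProduct, add_dotProduct, dotProduct_add, dotProduct_sub] at h₁ h₂ ⊢
  simp only [dotProduct_comm q p, dotProduct_comm u p, dotProduct_comm s p,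
    dotProduct_comm u q, dotProduct_comm s q,
    dotProduct_comm s u, dotProduct_comm s v, dotProduct_comm ys yp, dotProduct_comm ys yk,
    dotProduct_comm yk yp] at h₁ h₂ ⊢
  linarith
end

section
/- Suppose (x*, y*, λ*) is a solution of the variational inequality VI(F, θ, Ω), (x⁺, y⁺, λ⁺) is a linearized ADMM step from (y^k, λ^k) with parameters β, δ, and let ε ∈ (0, 1/2) be such that the matrix D = δ·I_{n₂} − (1/(2ε))·BᵀB is positive definite. Then δβ·‖y⁺ − y*‖² + (1/β)·‖λ⁺ − λ*‖² ≤ δβ·‖y^k − y*‖² + (1/β)·‖λ^k − λ*‖² − β·(y⁺ − y^k)ᵀD(y⁺ − y^k) − ((1 − 2ε)/β)·‖λ⁺ − λ^k‖². -/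
open Matrix Filter

variable {m n₁ n₂ : ℕ}

/-- Moving a matrix across the dot product. -/
lemma dotProduct_transpose_mulVec_eq_s11 {p q : ℕ} (M : Matrix (Fin p) (Fin q) ℝ)
    (u : Fin q → ℝ) (v : Fin p → ℝ) : u ⬝ᵥ (Mᵀ *ᵥ v) = (M *ᵥ u) ⬝ᵥ v := by
  rw [dotProduct_mulVec, vecMul_transpose]

/-- Young's inequality `2 u ⬝ v ≤ 2 ε ‖u‖² + ‖v‖² / (2 ε)`. -/
lemma two_mul_dotProduct_le {p : ℕ} {ε : ℝ} (hε : 0 < ε) (u v : Fin p → ℝ) :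
    2 * (u ⬝ᵥ v) ≤ 2 * ε * (u ⬝ᵥ u) + 1 / (2 * ε) * (v ⬝ᵥ v) := by
  have h : 0 ≤ ((2 * ε) • u - v) ⬝ᵥ ((2 * ε) • u - v) :=
    Finset.sum_nonneg fun i _ => mul_self_nonneg _
  simp only [sub_dotProduct, dotProduct_sub, smul_dotProduct, dotProduct_smul, smul_eq_mul,
    dotProduct_comm v u] at h
  have h' := mul_nonneg (show 0 ≤ 1 / (2 * ε) by positivity) h
  field_simp at h' ⊢
  linarith

/-- Theorem 3.1. -/
theorem stmt11 (hm : 0 < m) (hn₁ : 0 < n₁) (hn₂ : 0 < n₂)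
    (A : Matrix (Fin m) (Fin n₁) ℝ) (B : Matrix (Fin m) (Fin n₂) ℝ) (b : Fin m → ℝ)
    (X : Set (Fin n₁ → ℝ)) (Y : Set (Fin n₂ → ℝ))
    (hXc : IsClosed X) (hXconv : Convex ℝ X) (hYc : IsClosed Y) (hYconv : Convex ℝ Y)
    (θ₁ : (Fin n₁ → ℝ) → ℝ) (θ₂ : (Fin n₂ → ℝ) → ℝ)
    (hθ₁ : ConvexOn ℝ Set.univ θ₁) (hθ₂ : ConvexOn ℝ Set.univ θ₂)
    (β δ : ℝ) (hβ : 0 < β) (hδ : 0 < δ)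
    (xs : Fin n₁ → ℝ) (ys : Fin n₂ → ℝ) (ls : Fin m → ℝ)
    (hsol : VISolution A B b X Y θ₁ θ₂ xs ys ls)
    (yk : Fin n₂ → ℝ) (hyk : yk ∈ Y) (lk : Fin m → ℝ)
    (xp : Fin n₁ → ℝ) (yp : Fin n₂ → ℝ) (lp : Fin m → ℝ)
    (hstep : ADMMStep A B b X Y θ₁ θ₂ β δ yk lk xp yp lp)
    (ε : ℝ) (hε : ε ∈ Set.Ioo (0 : ℝ) (1 / 2))
    (D : Matrix (Fin n₂) (Fin n₂) ℝ)
    (hD : D = δ • (1 : Matrix (Fin n₂) (Fin n₂) ℝ) - (1 / (2 * ε)) • (Bᵀ * B))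
    (hDpos : D.PosDef) :
    δ * β * ((yp - ys) ⬝ᵥ (yp - ys)) + (1 / β) * ((lp - ls) ⬝ᵥ (lp - ls))
      ≤ δ * β * ((yk - ys) ⬝ᵥ (yk - ys)) + (1 / β) * ((lk - ls) ⬝ᵥ (lk - ls))
        - β * ((yp - yk) ⬝ᵥ (D *ᵥ (yp - yk)))
        - ((1 - 2 * ε) / β) * ((lp - lk) ⬝ᵥ (lp - lk)) := by
  obtain ⟨hxs, hys, hx, hy, hb⟩ := hsol
  obtain ⟨hxp, hyp, hx', hy', hl⟩ := hstep
  have hx := hx xp hxp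
  have hy := hy yp hyp
  have hx' := hx' xs hxs
  have hy' := hy' ys hys
  obtain ⟨u, rfl⟩ : ∃ u, xp = xs + u := ⟨xp - xs, by abel⟩
  obtain ⟨v, rfl⟩ : ∃ v, yp = ys + v := ⟨yp - ys, by abel⟩
  obtain ⟨w, rfl⟩ : ∃ w, yk = ys + v - w := ⟨ys + v - yk, by abel⟩
  obtain ⟨e, rfl⟩ : ∃ e, lp = ls + e := ⟨lp - ls, by abel⟩
  obtain ⟨r, hr⟩ : ∃ r, r = A *ᵥ u + B *ᵥ v := ⟨_, rfl⟩
  have hres : A *ᵥ (xs + u) + B *ᵥ (ys + v) - b = r := by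
    rw [mulVec_add, mulVec_add, ← hb, hr]; abel
  have hres' : A *ᵥ (xs + u) + B *ᵥ (ys + v - w) - b = r - B *ᵥ w := by
    rw [mulVec_sub, ← hres]; abel
  rw [hres] at hl
  obtain rfl : lk = ls + e + β • r := by rw [hl]; abel
  rw [hres'] at hx' hy'
  have amgm := mul_le_mul_of_nonneg_left (two_mul_dotProduct_le hε.1 r (B *ᵥ w)) hβ.le
  have hsum : 0 ≤ r ⬝ᵥ e + β * (r ⬝ᵥ (B *ᵥ w)) - β * δ * (v ⬝ᵥ w) := by
    have e1 : xs - (xs + u) = -u := by abel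
    have e2 : ys - (ys + v) = -v := by abel
    have e3 : ys + v - (ys + v - w) = w := by abel
    rw [e1] at hx'
    rw [e2, e3] at hy'
    rw [add_sub_cancel_left] at hx hy
    simp only [neg_dotProduct, dotProduct_add, dotProduct_neg, dotProduct_smul, smul_eq_mul,
      dotProduct_transpose_mulVec_eq_s11, dotProduct_sub] at hx hy hx' hy'
    have hrr : ∀ z : Fin m → ℝ, r ⬝ᵥ z = (A *ᵥ u) ⬝ᵥ z + (B *ᵥ v) ⬝ᵥ z := fun z => by
      rw [hr, add_dotProduct]
    rw [hrr, hrr]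
    linarith
  have hDw : w ⬝ᵥ (D *ᵥ w) = δ * (w ⬝ᵥ w) - 1 / (2 * ε) * ((B *ᵥ w) ⬝ᵥ (B *ᵥ w)) := by
    rw [hD, sub_mulVec, smul_mulVec, smul_mulVec, one_mulVec, ← mulVec_mulVec, dotProduct_sub,
      dotProduct_smul, dotProduct_smul, dotProduct_transpose_mulVec_eq_s11, smul_eq_mul, smul_eq_mul]
  have f1 : ys + v - ys = v := by abel
  have f2 : ls + e - ls = e := by abel
  have f3 : ys + v - w - ys = v - w := by abel
  have f4 : ls + e + β • r - ls = e + β • r := by abel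
  have f5 : ys + v - (ys + v - w) = w := by abel
  have f6 : ls + e - (ls + e + β • r) = -(β • r) := by abel
  rw [f1, f2, f3, f4, f5, f6, hDw]
  simp only [sub_dotProduct, dotProduct_sub, add_dotProduct, dotProduct_add, neg_dotProduct,
    dotProduct_neg, smul_dotProduct, dotProduct_smul, smul_eq_mul, dotProduct_comm w v,
    dotProduct_comm e r]
  have hβ' : β ≠ 0 := hβ.ne'
  have g1 : 1 / β * (e ⬝ᵥ e + β * (r ⬝ᵥ e) + β * (r ⬝ᵥ e + β * (r ⬝ᵥ r)))
      = 1 / β * (e ⬝ᵥ e) + 2 * (r ⬝ᵥ e) + β * (r ⬝ᵥ r) := by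
    field_simp; ring
  have g2 : (1 - 2 * ε) / β * -(β * -(β * (r ⬝ᵥ r))) = (1 - 2 * ε) * β * (r ⬝ᵥ r) := by
    field_simp
  rw [g1, g2]
  linarith
end

section
/- Let β > 0, ε ∈ (0, 1/2), and suppose θ₁ and θ₂ are continuous, A has full column rank (Ax = 0 implies x = 0), and there exists at least one solution of the variational inequality VI(F, θ, Ω). Let (δ_k)_{k≥0} be a sequence of reals with 1 ≤ δ_k ≤ Δ for all k for some constant Δ, with Σ_{k=0}^∞ max{0, δ_{k+1} − δ_k} < ∞, and suppose there exists c > 0 such that δ_k·‖z‖² − (1/(2ε))·‖Bz‖² ≥ c·‖z‖² for all k ≥ 0 and all z ∈ ℝ^{n₂}. Let y^0 ∈ Y, λ^0 ∈ ℝ^m, and suppose that for every k ≥ 0 the triple (x^{k+1}, y^{k+1}, λ^{k+1}) is a linearized ADMM step from (y^k, λ^k) with parameters β, δ_k. Then there exists (x^∞, y^∞, λ^∞) ∈ X × Y × ℝ^m which is a solution of the variational inequality VI(F, θ, Ω) and such that x^k → x^∞, y^k → y^∞ and λ^k → λ^∞ as k → ∞. -/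
open Matrix Filter

variable {m n₁ n₂ : ℕ}

lemma sub_dotProduct_transpose_mulVec {m n : ℕ} (M : Matrix (Fin m) (Fin n) ℝ)
    (u v : Fin n → ℝ) (w : Fin m → ℝ) :
    (u - v) ⬝ᵥ (Mᵀ *ᵥ w) = (M *ᵥ u - M *ᵥ v) ⬝ᵥ w := by
  rw [dotProduct_mulVec, vecMul_transpose, mulVec_sub]

lemma dotProduct_self_nonneg_real {n : ℕ} (v : Fin n → ℝ) : 0 ≤ v ⬝ᵥ v :=
  Finset.sum_nonneg fun i _ => mul_self_nonneg (v i)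

lemma tendsto_zero_of_dotProduct_self {ι : Type*} {f : Filter ι} {n : ℕ}
    {u : ι → Fin n → ℝ} (h : Tendsto (fun k => u k ⬝ᵥ u k) f (nhds 0)) :
    Tendsto u f (nhds 0) := by
  rw [tendsto_pi_nhds]
  intro i
  have hsq : Tendsto (fun k => u k i ^ 2) f (nhds 0) := by
    refine squeeze_zero (fun k => sq_nonneg _) (fun k => ?_) h
    rw [pow_two]
    exact Finset.single_le_sum (f := fun j => u k j * u k j)
      (fun j _ => mul_self_nonneg _) (Finset.mem_univ i)
  have habs : Tendsto (fun k => |u k i|) f (nhds 0) := by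
    simpa [Real.sqrt_sq_eq_abs] using hsq.sqrt
  exact (tendsto_zero_iff_abs_tendsto_zero _).2 habs

lemma isBounded_range_of_dotProduct_self_le {n : ℕ} {u : ℕ → Fin n → ℝ} {C : ℝ}
    {v : Fin n → ℝ} (h : ∀ k, (u k - v) ⬝ᵥ (u k - v) ≤ C) :
    Bornology.IsBounded (Set.range u) := by
  refine (Metric.isBounded_closedBall (x := v) (r := Real.sqrt C)).subset ?_
  rintro _ ⟨k, rfl⟩
  rw [Metric.mem_closedBall, dist_eq_norm, pi_norm_le_iff_of_nonneg (Real.sqrt_nonneg _)]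
  intro i
  rw [Real.norm_eq_abs]
  refine Real.abs_le_sqrt (le_trans ?_ (h k))
  rw [pow_two]
  exact Finset.single_le_sum (f := fun j => (u k - v) j * (u k - v) j)
    (fun j _ => mul_self_nonneg _) (Finset.mem_univ i)

lemma le_exp_tsum_mul_of_le_one_add_mul {V s : ℕ → ℝ} (hV : ∀ k, 0 ≤ V k)
    (hs : ∀ k, 0 ≤ s k) (hsum : Summable s) (h : ∀ k, V (k + 1) ≤ (1 + s k) * V k)
    {k n : ℕ} (hkn : k ≤ n) : V n ≤ Real.exp (∑' i, s i) * V k := by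
  have hfin : V n ≤ Real.exp (∑ i ∈ Finset.Ico k n, s i) * V k := by
    induction n, hkn using Nat.le_induction with
    | base => simp
    | succ n hkn ih =>
      rw [Finset.sum_Ico_succ_top hkn, Real.exp_add]
      calc V (n + 1) ≤ (1 + s n) * V n := h n
        _ ≤ Real.exp (s n) * (Real.exp (∑ i ∈ Finset.Ico k n, s i) * V k) := by
            have := Real.add_one_le_exp (s n)
            have := hs n
            exact mul_le_mul (by linarith) ih (hV n) (Real.exp_pos _).le
        _ = _ := by ring
  refine hfin.trans (mul_le_mul_of_nonneg_right (Real.exp_le_exp.2 ?_) (hV k))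
  exact hsum.sum_le_tsum _ fun i _ => hs i

lemma summable_of_le_one_add_mul_sub {V s d : ℕ → ℝ} (hV : ∀ k, 0 ≤ V k)
    (hs : ∀ k, 0 ≤ s k) (hd : ∀ k, 0 ≤ d k) (hsum : Summable s)
    (h : ∀ k, V (k + 1) ≤ (1 + s k) * V k - d k) : Summable d := by
  set K := Real.exp (∑' i, s i) * V 0
  have hK : ∀ k, V k ≤ K := fun k =>
    le_exp_tsum_mul_of_le_one_add_mul hV hs hsum
      (fun j => (h j).trans (sub_le_self _ (hd j))) (Nat.zero_le k)
  have hpartial : ∀ n, ∑ i ∈ Finset.range n, d i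
      ≤ V 0 - V n + (∑ i ∈ Finset.range n, s i) * K := by
    intro n
    induction n with
    | zero => simp
    | succ n ih =>
      rw [Finset.sum_range_succ, Finset.sum_range_succ]
      have := mul_le_mul_of_nonneg_left (hK n) (hs n)
      linarith [h n]
  refine summable_of_sum_range_le (c := V 0 + (∑' i, s i) * K) hd fun n => ?_
  have h1 := mul_le_mul_of_nonneg_right
    (hsum.sum_le_tsum (Finset.range n) fun i _ => hs i) ((hV 0).trans (hK 0))
  linarith [hpartial n, hV n]

lemma ADMMStep.x_vi {A : Matrix (Fin m) (Fin n₁) ℝ} {B : Matrix (Fin m) (Fin n₂) ℝ}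
    {b : Fin m → ℝ} {X : Set (Fin n₁ → ℝ)} {Y : Set (Fin n₂ → ℝ)}
    {θ₁ : (Fin n₁ → ℝ) → ℝ} {θ₂ : (Fin n₂ → ℝ) → ℝ} {β δ : ℝ}
    {yk : Fin n₂ → ℝ} {lk : Fin m → ℝ}
    {xp : Fin n₁ → ℝ} {yp : Fin n₂ → ℝ} {lp : Fin m → ℝ}
    (h : ADMMStep A B b X Y θ₁ θ₂ β δ yk lk xp yp lp) {x : Fin n₁ → ℝ} (hx : x ∈ X) :
    0 ≤ θ₁ x - θ₁ xp + (A *ᵥ x - A *ᵥ xp) ⬝ᵥ (β • (B *ᵥ (yk - yp)) - lp) := by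
  obtain ⟨-, -, h1, -, hl⟩ := h
  have := h1 x hx
  rw [← mulVec_smul, ← mulVec_neg, ← mulVec_add, sub_dotProduct_transpose_mulVec] at this
  have e : -lk + β • (A *ᵥ xp + B *ᵥ yk - b) = β • (B *ᵥ (yk - yp)) - lp := by
    rw [hl, mulVec_sub]; module
  rwa [e] at this

lemma ADMMStep.y_vi {A : Matrix (Fin m) (Fin n₁) ℝ} {B : Matrix (Fin m) (Fin n₂) ℝ}
    {b : Fin m → ℝ} {X : Set (Fin n₁ → ℝ)} {Y : Set (Fin n₂ → ℝ)}
    {θ₁ : (Fin n₁ → ℝ) → ℝ} {θ₂ : (Fin n₂ → ℝ) → ℝ} {β δ : ℝ}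
    {yk : Fin n₂ → ℝ} {lk : Fin m → ℝ}
    {xp : Fin n₁ → ℝ} {yp : Fin n₂ → ℝ} {lp : Fin m → ℝ}
    (h : ADMMStep A B b X Y θ₁ θ₂ β δ yk lk xp yp lp) {y : Fin n₂ → ℝ} (hy : y ∈ Y) :
    0 ≤ θ₂ y - θ₂ yp + ((B *ᵥ y - B *ᵥ yp) ⬝ᵥ (β • (B *ᵥ (yk - yp)) - lp)
      - β * δ * ((y - yp) ⬝ᵥ (yk - yp))) := by
  obtain ⟨-, -, -, h2, hl⟩ := h
  have := h2 y hy
  rw [← mulVec_smul, ← mulVec_neg, ← mulVec_add, dotProduct_add,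
    sub_dotProduct_transpose_mulVec] at this
  have e : -lk + β • (A *ᵥ xp + B *ᵥ yk - b) = β • (B *ᵥ (yk - yp)) - lp := by
    rw [hl, mulVec_sub]; module
  rw [e, dotProduct_smul, ← neg_sub yk yp, dotProduct_neg, smul_eq_mul] at this
  linarith

lemma ADMMStep.mulVec_x_eq {A : Matrix (Fin m) (Fin n₁) ℝ} {B : Matrix (Fin m) (Fin n₂) ℝ}
    {b : Fin m → ℝ} {X : Set (Fin n₁ → ℝ)} {Y : Set (Fin n₂ → ℝ)}
    {θ₁ : (Fin n₁ → ℝ) → ℝ} {θ₂ : (Fin n₂ → ℝ) → ℝ} {β δ : ℝ}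
    {yk : Fin n₂ → ℝ} {lk : Fin m → ℝ}
    {xp : Fin n₁ → ℝ} {yp : Fin n₂ → ℝ} {lp : Fin m → ℝ}
    (h : ADMMStep A B b X Y θ₁ θ₂ β δ yk lk xp yp lp) (hβ : 0 < β) :
    A *ᵥ xp = β⁻¹ • (lk - lp) + b - B *ᵥ yp := by
  have e : lk - lp = β • (A *ᵥ xp + B *ᵥ yp - b) := by rw [h.2.2.2.2]; module
  rw [e, inv_smul_smul₀ hβ.ne']
  module

/-- One step decreases the weighted squared distance to any solution. -/
lemma ADMMStep.fejer {A : Matrix (Fin m) (Fin n₁) ℝ} {B : Matrix (Fin m) (Fin n₂) ℝ}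
    {b : Fin m → ℝ} {X : Set (Fin n₁ → ℝ)} {Y : Set (Fin n₂ → ℝ)}
    {θ₁ : (Fin n₁ → ℝ) → ℝ} {θ₂ : (Fin n₂ → ℝ) → ℝ} {β δ ε c : ℝ}
    {yk : Fin n₂ → ℝ} {lk : Fin m → ℝ}
    {xp : Fin n₁ → ℝ} {yp : Fin n₂ → ℝ} {lp : Fin m → ℝ}
    {xs : Fin n₁ → ℝ} {ys : Fin n₂ → ℝ} {ls : Fin m → ℝ}
    (h : ADMMStep A B b X Y θ₁ θ₂ β δ yk lk xp yp lp) (hβ : 0 < β) (hε : 0 < ε)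
    (hcoerc : ∀ z : Fin n₂ → ℝ,
      δ * (z ⬝ᵥ z) - (1 / (2 * ε)) * ((B *ᵥ z) ⬝ᵥ (B *ᵥ z)) ≥ c * (z ⬝ᵥ z))
    (hs : VISolution A B b X Y θ₁ θ₂ xs ys ls) :
    β⁻¹ * ((lp - ls) ⬝ᵥ (lp - ls)) + β * δ * ((yp - ys) ⬝ᵥ (yp - ys)) ≤
      β⁻¹ * ((lk - ls) ⬝ᵥ (lk - ls)) + β * δ * ((yk - ys) ⬝ᵥ (yk - ys))
        - ((1 - 2 * ε) * β⁻¹ * ((lk - lp) ⬝ᵥ (lk - lp))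
          + β * c * ((yk - yp) ⬝ᵥ (yk - yp))) := by
  obtain ⟨hxs, hys, hs1, hs2, hfeas⟩ := hs
  have hx := h.x_vi hxs
  have hy := h.y_vi hys
  have hx' := hs1 xp h.1
  have hy' := hs2 yp h.2.1
  rw [← mulVec_neg, sub_dotProduct_transpose_mulVec] at hx' hy'
  have hAp := h.mulVec_x_eq hβ
  have hAs : A *ᵥ xs = b - B *ᵥ ys := eq_sub_of_add_eq hfeas
  have hc := hcoerc (yk - yp)
  have hsq := dotProduct_self_nonneg_real
    ((2 * ε) • (lk - lp) + β • (B *ᵥ (yk - yp)))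
  have hdiff : A *ᵥ xp - A *ᵥ xs = β⁻¹ • (lk - lp) - (B *ᵥ yp - B *ᵥ ys) := by
    rw [hAp, hAs]; module
  rw [← neg_sub (A *ᵥ xp), hdiff] at hx
  rw [hdiff] at hx'
  set q := yk - yp with hq
  set v := lk - lp with hv
  set u := lp - ls with hu
  set p := yp - ys with hp
  have e1 : lk - ls = u + v := by rw [hu, hv]; module
  have e2 : yk - ys = p + q := by rw [hp, hq]; module
  have e3 : ys - yp = -p := by rw [hp]; module
  have e4 : B *ᵥ ys - B *ᵥ yp = -(B *ᵥ yp - B *ᵥ ys) := by module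
  have e5 : lp = u + ls := by rw [hu]; module
  rw [e4, e3] at hy
  rw [e1, e2]
  rw [e5] at hx hy
  generalize B *ᵥ yp - B *ᵥ ys = Bp at *
  generalize B *ᵥ q = Bq at *
  have hmain : 0 ≤ β⁻¹ * (v ⬝ᵥ u) - v ⬝ᵥ Bq + β * δ * (p ⬝ᵥ q) := by
    have e : β⁻¹ * (β * (v ⬝ᵥ Bq)) = v ⬝ᵥ Bq := inv_mul_cancel_left₀ hβ.ne' _
    simp only [sub_dotProduct, dotProduct_sub, neg_dotProduct, dotProduct_neg,
      dotProduct_add, smul_dotProduct, dotProduct_smul, smul_eq_mul] at hx hy hx' hy'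
    linarith
  have hcross : 0 ≤ 2 * ε * β⁻¹ * (v ⬝ᵥ v) + 2 * (v ⬝ᵥ Bq)
      + β * (1 / (2 * ε)) * (Bq ⬝ᵥ Bq) := by
    simp only [add_dotProduct, dotProduct_add, smul_dotProduct, dotProduct_smul,
      smul_eq_mul, dotProduct_comm Bq v] at hsq
    have : 2 * ε * β⁻¹ * (v ⬝ᵥ v) + 2 * (v ⬝ᵥ Bq) + β * (1 / (2 * ε)) * (Bq ⬝ᵥ Bq)
        = (2 * ε * β)⁻¹ * (2 * ε * (2 * ε * (v ⬝ᵥ v)) + β * (2 * ε * (v ⬝ᵥ Bq))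
          + (2 * ε * (β * (v ⬝ᵥ Bq)) + β * (β * (Bq ⬝ᵥ Bq)))) := by
      field_simp
      ring
    rw [this]
    refine mul_nonneg (by positivity) ?_
    linarith
  have hc' := mul_le_mul_of_nonneg_left hc.le hβ.le
  simp only [add_dotProduct, dotProduct_add, dotProduct_comm v u, dotProduct_comm q p]
    at hmain ⊢
  linarith

lemma VISolution.of_tendsto {A : Matrix (Fin m) (Fin n₁) ℝ} {B : Matrix (Fin m) (Fin n₂) ℝ}
    {b : Fin m → ℝ} {X : Set (Fin n₁ → ℝ)} {Y : Set (Fin n₂ → ℝ)}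
    {θ₁ : (Fin n₁ → ℝ) → ℝ} {θ₂ : (Fin n₂ → ℝ) → ℝ} {β Δ : ℝ} (hβ : 0 < β)
    (hXc : IsClosed X) (hYc : IsClosed Y) (hθ₁ : Continuous θ₁) (hθ₂ : Continuous θ₂)
    {δ : ℕ → ℝ} (hδ0 : ∀ k, 0 ≤ δ k) (hδ : ∀ k, δ k ≤ Δ)
    {y yp : ℕ → Fin n₂ → ℝ} {l lp : ℕ → Fin m → ℝ} {xp : ℕ → Fin n₁ → ℝ}
    (hstep : ∀ k, ADMMStep A B b X Y θ₁ θ₂ β (δ k) (y k) (l k) (xp k) (yp k) (lp k))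
    {xi : Fin n₁ → ℝ} {yi : Fin n₂ → ℝ} {li : Fin m → ℝ}
    (hx : Tendsto xp atTop (nhds xi)) (hy : Tendsto y atTop (nhds yi))
    (hyp : Tendsto yp atTop (nhds yi)) (hl : Tendsto l atTop (nhds li))
    (hlp : Tendsto lp atTop (nhds li)) : VISolution A B b X Y θ₁ θ₂ xi yi li := by
  have hmul : ∀ {n : ℕ} (M : Matrix (Fin m) (Fin n) ℝ), Continuous fun z => M *ᵥ z :=
    fun M => continuous_const.matrix_mulVec continuous_id
  have hdot : ∀ {n : ℕ} {f g : ℕ → Fin n → ℝ} {a b : Fin n → ℝ},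
      Tendsto f atTop (nhds a) → Tendsto g atTop (nhds b) →
      Tendsto (fun k => f k ⬝ᵥ g k) atTop (nhds (a ⬝ᵥ b)) := fun {n f g a b} hf hg => by
    have hc : Continuous fun z : (Fin n → ℝ) × (Fin n → ℝ) => z.1 ⬝ᵥ z.2 :=
      continuous_fst.dotProduct continuous_snd
    exact (hc.tendsto (a, b)).comp (hf.prodMk_nhds hg)
  have hAx := ((hmul A).tendsto xi).comp hx
  have hBy := ((hmul B).tendsto yi).comp hyp
  have hres : Tendsto (fun k => β • (B *ᵥ (y k - yp k)) - lp k) atTop (nhds (-li)) := by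
    simpa using ((((hmul B).tendsto _).comp (hy.sub hyp)).const_smul β).sub hlp
  refine ⟨hXc.mem_of_tendsto hx (.of_forall fun k => (hstep k).1),
    hYc.mem_of_tendsto hyp (.of_forall fun k => (hstep k).2.1), fun z hz => ?_,
    fun z hz => ?_, ?_⟩
  · rw [← mulVec_neg, sub_dotProduct_transpose_mulVec]
    exact ge_of_tendsto' ((((hθ₁.tendsto _).comp hx).const_sub (θ₁ z)).add
      (hdot (hAx.const_sub (A *ᵥ z)) hres)) fun k => (hstep k).x_vi hz
  · rw [← mulVec_neg, sub_dotProduct_transpose_mulVec]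
    have hprox : Tendsto (fun k => β * δ k * ((z - yp k) ⬝ᵥ (y k - yp k))) atTop (nhds 0) := by
      have h0 : Tendsto (fun k => (z - yp k) ⬝ᵥ (y k - yp k)) atTop (nhds 0) := by
        simpa using hdot (hyp.const_sub z) (hy.sub hyp)
      refine squeeze_zero_norm (a := fun k => β * Δ * ‖(z - yp k) ⬝ᵥ (y k - yp k)‖)
        (fun k => ?_) (by simpa using h0.norm.const_mul (β * Δ))
      rw [norm_mul, Real.norm_of_nonneg (mul_nonneg hβ.le (hδ0 k))]
      have := hδ k
      gcongr
    have := ge_of_tendsto' ((((hθ₂.tendsto _).comp hyp).const_sub (θ₂ z)).add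
      ((hdot (hBy.const_sub (B *ᵥ z)) hres).sub hprox)) fun k => (hstep k).y_vi hz
    simpa using this
  · have hlim : Tendsto (fun k => β⁻¹ • (l k - lp k) + b - B *ᵥ yp k) atTop
        (nhds (β⁻¹ • (li - li) + b - B *ᵥ yi)) :=
      (((hl.sub hlp).const_smul β⁻¹).add_const b).sub hBy
    have := tendsto_nhds_unique (hAx.congr fun k => (hstep k).mulVec_x_eq hβ) hlim
    rw [this]; simp

/-- Theorem 3.4: global convergence of the adaptive
linearized ADMM sequence to a solution of `VI(F, θ, Ω)`. -/
theorem stmt15 (hm : 0 < m) (hn₁ : 0 < n₁) (hn₂ : 0 < n₂)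
    (A : Matrix (Fin m) (Fin n₁) ℝ) (B : Matrix (Fin m) (Fin n₂) ℝ) (b : Fin m → ℝ)
    (X : Set (Fin n₁ → ℝ)) (Y : Set (Fin n₂ → ℝ))
    (hXc : IsClosed X) (hXconv : Convex ℝ X) (hYc : IsClosed Y) (hYconv : Convex ℝ Y)
    (θ₁ : (Fin n₁ → ℝ) → ℝ) (θ₂ : (Fin n₂ → ℝ) → ℝ)
    (hθ₁ : ConvexOn ℝ Set.univ θ₁) (hθ₂ : ConvexOn ℝ Set.univ θ₂)
    (hθ₁cont : Continuous θ₁) (hθ₂cont : Continuous θ₂)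
    (hA : ∀ z : Fin n₁ → ℝ, A *ᵥ z = 0 → z = 0)
    (hexists : ∃ (xs : Fin n₁ → ℝ) (ys : Fin n₂ → ℝ) (ls : Fin m → ℝ),
      VISolution A B b X Y θ₁ θ₂ xs ys ls)
    (β ε : ℝ) (hβ : 0 < β) (hε : ε ∈ Set.Ioo (0 : ℝ) (1 / 2))
    (δ : ℕ → ℝ) (hδ1 : ∀ k, 1 ≤ δ k)
    (Δ : ℝ) (hδΔ : ∀ k, δ k ≤ Δ)
    (hδsum : Summable (fun k => max 0 (δ (k + 1) - δ k)))
    (c : ℝ) (hc : 0 < c)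
    (hcoerc : ∀ (k : ℕ) (z : Fin n₂ → ℝ),
      δ k * (z ⬝ᵥ z) - (1 / (2 * ε)) * ((B *ᵥ z) ⬝ᵥ (B *ᵥ z)) ≥ c * (z ⬝ᵥ z))
    (x : ℕ → Fin n₁ → ℝ) (y : ℕ → Fin n₂ → ℝ) (l : ℕ → Fin m → ℝ)
    (hy0 : y 0 ∈ Y)
    (hstep : ∀ k : ℕ,
      ADMMStep A B b X Y θ₁ θ₂ β (δ k) (y k) (l k) (x (k + 1)) (y (k + 1)) (l (k + 1))) :
    ∃ (xi : Fin n₁ → ℝ) (yi : Fin n₂ → ℝ) (li : Fin m → ℝ),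
      VISolution A B b X Y θ₁ θ₂ xi yi li ∧
        Tendsto x atTop (nhds xi) ∧
        Tendsto y atTop (nhds yi) ∧
        Tendsto l atTop (nhds li) := by
  have hδ0 : ∀ k, 0 < δ k := fun k => one_pos.trans_le (hδ1 k)
  have hε2 : 0 < 1 - 2 * ε := by linarith [hε.2]
  have hβ' : 0 < β⁻¹ := inv_pos.2 hβ
  set s : ℕ → ℝ := fun k => max 0 (δ (k + 1) - δ k)
  have hs : ∀ k, 0 ≤ s k := fun k => le_max_left _ _
  let d : ℕ → ℝ := fun k =>
    (1 - 2 * ε) * β⁻¹ * ((l k - l (k + 1)) ⬝ᵥ (l k - l (k + 1)))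
      + β * c * ((y k - y (k + 1)) ⬝ᵥ (y k - y (k + 1)))
  have hdl : ∀ k, 0 ≤ (1 - 2 * ε) * β⁻¹ * ((l k - l (k + 1)) ⬝ᵥ (l k - l (k + 1))) :=
    fun k => mul_nonneg (by positivity) (dotProduct_self_nonneg_real _)
  have hdy : ∀ k, 0 ≤ β * c * ((y k - y (k + 1)) ⬝ᵥ (y k - y (k + 1))) :=
    fun k => mul_nonneg (by positivity) (dotProduct_self_nonneg_real _)
  have hd : ∀ k, 0 ≤ d k := fun k => add_nonneg (hdl k) (hdy k)
  let V : (Fin n₂ → ℝ) → (Fin m → ℝ) → ℕ → ℝ := fun ys ls k =>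
    β⁻¹ * ((l k - ls) ⬝ᵥ (l k - ls)) + β * δ k * ((y k - ys) ⬝ᵥ (y k - ys))
  have hVl : ∀ ys ls k, β⁻¹ * ((l k - ls) ⬝ᵥ (l k - ls)) ≤ V ys ls k := fun ys ls k =>
    le_add_of_nonneg_right (mul_nonneg (mul_pos hβ (hδ0 k)).le (dotProduct_self_nonneg_real _))
  have hVy : ∀ ys ls k, β * ((y k - ys) ⬝ᵥ (y k - ys)) ≤ V ys ls k := fun ys ls k => by
    refine le_add_of_nonneg_of_le (mul_nonneg hβ'.le (dotProduct_self_nonneg_real _)) ?_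
    exact mul_le_mul_of_nonneg_right (le_mul_of_one_le_right hβ.le (hδ1 k))
      (dotProduct_self_nonneg_real _)
  have hV0 : ∀ ys ls k, 0 ≤ V ys ls k := fun ys ls k =>
    (mul_nonneg hβ'.le (dotProduct_self_nonneg_real _)).trans (hVl ys ls k)
  have hVstep : ∀ {xs ys ls}, VISolution A B b X Y θ₁ θ₂ xs ys ls →
      ∀ k, V ys ls (k + 1) ≤ (1 + s k) * V ys ls k - d k := by
    intro xs ys ls hsol k
    have hf : _ ≤ V ys ls k - d k := (hstep k).fejer hβ hε.1 (hcoerc k) hsol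
    have hδs : δ (k + 1) ≤ (1 + s k) * δ k := by
      have h1 : δ (k + 1) - δ k ≤ s k := le_max_right _ _
      nlinarith [hs k, hδ1 k]
    have hl0 := mul_nonneg hβ'.le (dotProduct_self_nonneg_real (l (k + 1) - ls))
    have hy0 := mul_nonneg hβ.le (dotProduct_self_nonneg_real (y (k + 1) - ys))
    have h2 := mul_le_mul_of_nonneg_right hδs hy0
    have h3 := mul_le_mul_of_nonneg_left hf (add_nonneg zero_le_one (hs k))
    have h4 := mul_nonneg (hs k) hl0
    have h5 := mul_nonneg (hs k) (hd k)
    change β⁻¹ * _ + β * δ (k + 1) * _ ≤ _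
    linarith
  obtain ⟨xs, ys, ls, hsol⟩ := hexists
  have hd_tendsto := (summable_of_le_one_add_mul_sub (hV0 ys ls) hs hd hδsum
    (hVstep hsol)).tendsto_atTop_zero
  have hdiff_l : Tendsto (fun k => l k - l (k + 1)) atTop (nhds 0) := by
    refine tendsto_zero_of_dotProduct_self ?_
    have := (squeeze_zero hdl (fun k => le_add_of_nonneg_right (hdy k)) hd_tendsto).const_mul
      ((1 - 2 * ε) * β⁻¹)⁻¹
    simpa only [mul_zero, inv_mul_cancel_left₀ (mul_pos hε2 hβ').ne'] using this
  have hdiff_y : Tendsto (fun k => y k - y (k + 1)) atTop (nhds 0) := by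
    refine tendsto_zero_of_dotProduct_self ?_
    have := (squeeze_zero hdy (fun k => le_add_of_nonneg_left (hdl k)) hd_tendsto).const_mul
      (β * c)⁻¹
    simpa only [mul_zero, inv_mul_cancel_left₀ (mul_pos hβ hc).ne'] using this
  have hVle : ∀ {xs ys ls}, VISolution A B b X Y θ₁ θ₂ xs ys ls → ∀ {k n}, k ≤ n →
      V ys ls n ≤ Real.exp (∑' i, s i) * V ys ls k := fun hsol _ _ hkn =>
    le_exp_tsum_mul_of_le_one_add_mul (hV0 _ _) hs hδsum
      (fun j => (hVstep hsol j).trans (sub_le_self _ (hd j))) hkn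
  have hbl : Bornology.IsBounded (Set.range l) :=
    isBounded_range_of_dotProduct_self_le (v := ls) fun k =>
      (le_inv_mul_iff₀ hβ').2 ((hVl ys ls k).trans (hVle hsol (Nat.zero_le k)))
  have hby : Bornology.IsBounded (Set.range y) :=
    isBounded_range_of_dotProduct_self_le (v := ys) fun k =>
      (le_inv_mul_iff₀ hβ).2 ((hVy ys ls k).trans (hVle hsol (Nat.zero_le k)))
  obtain ⟨⟨yi, li⟩, -, φ, hφ, hlim⟩ := tendsto_subseq_of_bounded (hby.prod hbl)
    (x := fun k => (y k, l k)) fun k => ⟨Set.mem_range_self k, Set.mem_range_self k⟩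
  have hyφ : Tendsto (fun k => y (φ k)) atTop (nhds yi) :=
    (continuous_fst.tendsto _).comp hlim
  have hlφ : Tendsto (fun k => l (φ k)) atTop (nhds li) :=
    (continuous_snd.tendsto _).comp hlim
  have hyφ1 : Tendsto (fun k => y (φ k + 1)) atTop (nhds yi) := by
    simpa using hyφ.sub (hdiff_y.comp hφ.tendsto_atTop)
  have hlφ1 : Tendsto (fun k => l (φ k + 1)) atTop (nhds li) := by
    simpa using hlφ.sub (hdiff_l.comp hφ.tendsto_atTop)
  obtain ⟨G, hG⟩ := A.mulVecLin.exists_leftInverse_of_injective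
    (LinearMap.ker_eq_bot'.2 fun z hz => hA z hz)
  have hGA : ∀ z, G (A *ᵥ z) = z := fun z => LinearMap.congr_fun hG z
  have hGc : Continuous G := G.continuous_of_finiteDimensional
  have hx_of_y : ∀ ψ : ℕ → ℕ, Tendsto ψ atTop atTop →
      Tendsto (fun k => y (ψ k + 1)) atTop (nhds yi) →
      Tendsto (fun k => x (ψ k + 1)) atTop (nhds (G (b - B *ᵥ yi))) := by
    intro ψ hψ hyψ
    have hB : Continuous fun z => B *ᵥ z := continuous_const.matrix_mulVec continuous_id
    have hAx : Tendsto (fun k => A *ᵥ x (ψ k + 1)) atTop (nhds (b - B *ᵥ yi)) := by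
      have := (((hdiff_l.comp hψ).const_smul β⁻¹).add_const b).sub ((hB.tendsto _).comp hyψ)
      rw [smul_zero, zero_add] at this
      exact this.congr fun k => ((hstep (ψ k)).mulVec_x_eq hβ).symm
    simpa only [Function.comp_def, hGA] using (hGc.tendsto _).comp hAx
  have hsol_i : VISolution A B b X Y θ₁ θ₂ (G (b - B *ᵥ yi)) yi li :=
    .of_tendsto hβ hXc hYc hθ₁cont hθ₂cont (fun k => (hδ0 (φ k)).le) (fun k => hδΔ (φ k))
      (fun k => hstep (φ k)) (hx_of_y φ hφ.tendsto_atTop hyφ1) hyφ hyφ1 hlφ hlφ1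
  have hsq : ∀ {n : ℕ} {f : ℕ → Fin n → ℝ} {a : Fin n → ℝ}, Tendsto f atTop (nhds a) →
      Tendsto (fun k => (f k - a) ⬝ᵥ (f k - a)) atTop (nhds 0) := fun {n f a} hf => by
    have hc : Continuous fun z : Fin n → ℝ => (z - a) ⬝ᵥ (z - a) := by fun_prop
    simpa [Function.comp_def] using (hc.tendsto a).comp hf
  have hVφ : Tendsto (fun k => V yi li (φ k)) atTop (nhds 0) := by
    refine squeeze_zero (fun k => hV0 _ _ _) (fun k => ?_)
      (g := fun k => β⁻¹ * ((l (φ k) - li) ⬝ᵥ (l (φ k) - li))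
        + β * Δ * ((y (φ k) - yi) ⬝ᵥ (y (φ k) - yi)))
      (by simpa using ((hsq hlφ).const_mul β⁻¹).add ((hsq hyφ).const_mul (β * Δ)))
    exact add_le_add_right (mul_le_mul_of_nonneg_right
      (mul_le_mul_of_nonneg_left (hδΔ _) hβ.le) (dotProduct_self_nonneg_real _)) _
  have hV : Tendsto (V yi li) atTop (nhds 0) := by
    have hexp := hVφ.const_mul (Real.exp (∑' i, s i))
    rw [mul_zero] at hexp
    refine tendsto_order.2 ⟨fun a ha => .of_forall fun k => ha.trans_le (hV0 _ _ _),
      fun a ha => ?_⟩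
    obtain ⟨N, hN⟩ := ((tendsto_order.1 hexp).2 a ha).exists
    filter_upwards [eventually_ge_atTop (φ N)] with n hn
    exact (hVle hsol_i hn).trans_lt hN
  have hl_lim : Tendsto l atTop (nhds li) := by
    rw [← tendsto_sub_nhds_zero_iff]
    refine tendsto_zero_of_dotProduct_self ?_
    have := (squeeze_zero (fun k => mul_nonneg hβ'.le (dotProduct_self_nonneg_real (l k - li)))
      (hVl yi li) hV).const_mul β
    simpa only [mul_zero, mul_inv_cancel_left₀ hβ.ne'] using this
  have hy_lim : Tendsto y atTop (nhds yi) := by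
    rw [← tendsto_sub_nhds_zero_iff]
    refine tendsto_zero_of_dotProduct_self ?_
    have := (squeeze_zero (fun k => mul_nonneg hβ.le (dotProduct_self_nonneg_real (y k - yi)))
      (hVy yi li) hV).const_mul β⁻¹
    simpa only [mul_zero, inv_mul_cancel_left₀ hβ.ne'] using this
  exact ⟨_, yi, li, hsol_i, (tendsto_add_atTop_iff_nat 1).1
    (hx_of_y id tendsto_id ((tendsto_add_atTop_iff_nat 1).2 hy_lim)), hy_lim, hl_lim⟩
end
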